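/- There exist constants c > 0, C > 0 and a natural number N such that for every n ≥ N there exists a simple graph G on n vertices which is 4-cycle-free, has at least c·n^{3/2} edges, at most C·n^{3/2} edges, and maximum degree at most C·n^{1/2}. -/

import Mathlib

/-- A 4-cycle in a simple graph: four pairwise distinct vertices `a, b, c, d` with
`a ~ b`, `b ~ c`, `c ~ d`, `d ~ a`. -/
def HasFourCycle {V : Type*} (G : SimpleGraph V) : Prop :=
  ∃ a b c d : V, a ≠ b ∧ a ≠ c ∧ a ≠ d ∧ b ≠ c ∧ b ≠ d ∧ c ≠ d ∧
    G.Adj a b ∧ G.Adj b c ∧ G.Adj c d ∧ G.Adj d a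

/-- The incidence graph between the points `(x, y)` and the non-vertical lines `y = m * x + b`
of the affine plane over `F`. -/
def affineIncidenceGraph (F : Type*) [Field F] : SimpleGraph ((F × F) ⊕ (F × F)) where
  Adj
    | .inl u, .inr l => u.2 = l.1 * u.1 + l.2
    | .inr l, .inl u => u.2 = l.1 * u.1 + l.2
    | _, _ => False
  symm := ⟨by rintro (u | u) (v | v) h <;> exact h⟩
  loopless := ⟨by rintro (u | u) h <;> exact h⟩

/-- Two distinct points lie on at most one common line. -/
theorem eq_or_eq_of_incidence {F : Type*} [Field F] {u v l k : F × F}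
    (hul : u.2 = l.1 * u.1 + l.2) (huk : u.2 = k.1 * u.1 + k.2)
    (hvl : v.2 = l.1 * v.1 + l.2) (hvk : v.2 = k.1 * v.1 + k.2) : u = v ∨ l = k := by
  have h : (l.1 - k.1) * (u.1 - v.1) = 0 := by linear_combination huk - hul + hvl - hvk
  rcases mul_eq_zero.mp h with h | h
  · have h1 : l.1 = k.1 := sub_eq_zero.mp h
    exact .inr (Prod.ext h1 (by linear_combination huk - hul - u.1 * h1))
  · have h1 : u.1 = v.1 := sub_eq_zero.mp h
    exact .inl (Prod.ext h1 (by linear_combination hul - hvl + l.1 * h1))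

theorem not_hasFourCycle_affineIncidenceGraph (F : Type*) [Field F] :
    ¬ HasFourCycle (affineIncidenceGraph F) := by
  rintro ⟨a, b, c, d, -, hac, -, -, hbd, -, hab, hbc, hcd, hda⟩
  rcases a with a | a <;> rcases b with b | b <;> rcases c with c | c <;> rcases d with d | d <;>
    simp only [affineIncidenceGraph] at hab hbc hcd hda
  · rcases eq_or_eq_of_incidence hab hda hbc hcd with h | h <;> simp_all
  · rcases eq_or_eq_of_incidence hab hbc hda hcd with h | h <;> simp_all

theorem ncard_edgeSet_affineIncidenceGraph (F : Type*) [Field F] :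
    (affineIncidenceGraph F).edgeSet.ncard = Nat.card F ^ 3 := by
  let f : F × F × F → Sym2 ((F × F) ⊕ (F × F)) :=
    fun t => s(.inl (t.1, t.2.1 * t.1 + t.2.2), .inr t.2)
  have hf : Function.Injective f := by
    rintro ⟨x, l⟩ ⟨y, k⟩ h
    simp_all [f]
  have hrange : (affineIncidenceGraph F).edgeSet = Set.range f := by
    ext e
    induction e with | _ u v
    simp only [SimpleGraph.mem_edgeSet, Set.mem_range]
    constructor
    · intro h
      rcases u with u | u <;> rcases v with v | v <;> simp only [affineIncidenceGraph] at h
      · exact ⟨(u.1, v), by simp [f, ← h]⟩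
      · exact ⟨(v.1, u), by simp [f, ← h]⟩
    · rintro ⟨t, ht⟩
      rcases Sym2.eq_iff.mp ht with ⟨rfl, rfl⟩ | ⟨rfl, rfl⟩ <;> simp [affineIncidenceGraph]
  rw [hrange, ← Nat.card_coe_set_eq, Nat.card_range_of_injective hf, Nat.card_prod, Nat.card_prod]
  ring

theorem ncard_neighborSet_affineIncidenceGraph_le (F : Type*) [Field F] [Finite F]
    (v : (F × F) ⊕ (F × F)) : ((affineIncidenceGraph F).neighborSet v).ncard ≤ Nat.card F := by
  suffices h : ∃ f : F → (F × F) ⊕ (F × F),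
      (affineIncidenceGraph F).neighborSet v ⊆ f '' Set.univ by
    obtain ⟨f, hf⟩ := h
    calc _ ≤ (f '' Set.univ).ncard := Set.ncard_le_ncard hf
      _ ≤ Set.univ.ncard := Set.ncard_image_le
      _ = Nat.card F := Set.ncard_univ F
  rcases v with u | l
  · refine ⟨fun m => .inr (m, u.2 - m * u.1), ?_⟩
    rintro (w | w) h <;> simp only [SimpleGraph.mem_neighborSet, affineIncidenceGraph] at h
    exact ⟨w.1, trivial, by simp [h]⟩
  · refine ⟨fun x => .inl (x, l.1 * x + l.2), ?_⟩
    rintro (w | w) h <;> simp only [SimpleGraph.mem_neighborSet, affineIncidenceGraph] at h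
    exact ⟨w.1, trivial, by simp [← h]⟩

theorem not_hasFourCycle_map {V W : Type*} {G : SimpleGraph V} (f : V ↪ W)
    (hG : ¬ HasFourCycle G) : ¬ HasFourCycle (G.map f) := by
  rintro ⟨_, _, _, _, hab, hac, had, hbc, hbd, hcd, h1, h2, h3, h4⟩
  obtain ⟨a, b, e1, rfl, rfl⟩ := (SimpleGraph.map_adj ..).mp h1
  obtain ⟨b', c, e2, hb, rfl⟩ := (SimpleGraph.map_adj ..).mp h2
  obtain ⟨c', d, e3, hc, rfl⟩ := (SimpleGraph.map_adj ..).mp h3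
  obtain ⟨d', a', e4, hd, ha⟩ := (SimpleGraph.map_adj ..).mp h4
  obtain rfl := f.injective hb
  obtain rfl := f.injective hc
  obtain rfl := f.injective hd
  obtain rfl := f.injective ha
  exact hG ⟨_, _, _, _, ne_of_apply_ne f hab, ne_of_apply_ne f hac, ne_of_apply_ne f had,
    ne_of_apply_ne f hbc, ne_of_apply_ne f hbd, ne_of_apply_ne f hcd, e1, e2, e3, e4⟩

theorem ncard_neighborSet_map_le {V W : Type*} [Finite V] {G : SimpleGraph V} (f : V ↪ W) {k : ℕ}
    (hG : ∀ v, (G.neighborSet v).ncard ≤ k) (w : W) : ((G.map f).neighborSet w).ncard ≤ k := by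
  by_cases hw : ∃ v, f v = w
  · obtain ⟨v, rfl⟩ := hw
    have hsub : (G.map f).neighborSet (f v) ⊆ f '' G.neighborSet v := by
      intro x hx
      obtain ⟨a, b, hab, ha, rfl⟩ := (SimpleGraph.map_adj ..).mp hx
      obtain rfl := f.injective ha
      exact ⟨b, hab, rfl⟩
    calc _ ≤ (f '' G.neighborSet v).ncard := Set.ncard_le_ncard hsub
      _ ≤ (G.neighborSet v).ncard := Set.ncard_image_le
      _ ≤ k := hG v
  · have hempty : (G.map f).neighborSet w = ∅ := by
      refine Set.eq_empty_of_forall_notMem fun x hx => hw ?_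
      obtain ⟨a, b, -, ha, -⟩ := (SimpleGraph.map_adj ..).mp hx
      exact ⟨a, ha⟩
    simp [hempty]

theorem exists_prime_two_mul_sq_le {n : ℕ} (hn : 8 ≤ n) :
    ∃ p : ℕ, p.Prime ∧ 2 * p ^ 2 ≤ n ∧ n ≤ 8 * p ^ 2 := by
  have hk : Nat.sqrt (n / 8) ≠ 0 := by
    rw [Ne, Nat.sqrt_eq_zero]
    omega
  obtain ⟨p, hp, hlt, hle⟩ := Nat.exists_prime_lt_and_le_two_mul _ hk
  refine ⟨p, hp, ?_, ?_⟩
  · have h1 := Nat.sqrt_le' (n / 8)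
    have h2 := Nat.pow_le_pow_left hle 2
    rw [mul_pow] at h2
    omega
  · have h1 := Nat.lt_succ_sqrt' (n / 8)
    have h2 := Nat.pow_le_pow_left (Nat.succ_le_of_lt hlt) 2
    omega

/-- There are constants `c, C > 0` and `N` such that for all `n ≥ N` there is a
4-cycle-free graph on `n` vertices with `Θ(n^{3/2})` edges and maximum degree `O(n^{1/2})`. -/
theorem exists_four_cycle_free_dense_graph :
    ∃ (c C : ℝ) (N : ℕ), 0 < c ∧ 0 < C ∧
      ∀ n : ℕ, N ≤ n → ∃ G : SimpleGraph (Fin n),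
        ¬ HasFourCycle G ∧
        c * (n : ℝ) ^ ((3 : ℝ) / 2) ≤ (G.edgeSet.ncard : ℝ) ∧
        (G.edgeSet.ncard : ℝ) ≤ C * (n : ℝ) ^ ((3 : ℝ) / 2) ∧
        ∀ v : Fin n, ((G.neighborSet v).ncard : ℝ) ≤ C * (n : ℝ) ^ ((1 : ℝ) / 2) := by
  refine ⟨(1 / 8) ^ ((3 : ℝ) / 2), 1, 8, by positivity, one_pos, fun n hn => ?_⟩
  obtain ⟨p, hp, hpn, hnp⟩ := exists_prime_two_mul_sq_le hn
  have : Fact p.Prime := ⟨hp⟩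
  obtain ⟨f⟩ : Nonempty ((ZMod p × ZMod p) ⊕ (ZMod p × ZMod p) ↪ Fin n) := by
    apply Function.Embedding.nonempty_of_card_le
    simp only [Fintype.card_sum, Fintype.card_prod, ZMod.card, Fintype.card_fin]
    linarith
  have hcube : ((p : ℝ) ^ 2) ^ ((3 : ℝ) / 2) = (p : ℝ) ^ 3 := by
    rw [← Real.rpow_natCast_mul (by positivity), ← Real.rpow_natCast]
    norm_num
  have hroot : ((p : ℝ) ^ 2) ^ ((1 : ℝ) / 2) = p := by
    rw [← Real.rpow_natCast_mul (by positivity)]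
    norm_num
  have hlower : (1 / 8 : ℝ) * n ≤ (p : ℝ) ^ 2 := by
    have : (n : ℝ) ≤ 8 * (p : ℝ) ^ 2 := mod_cast hnp
    linarith
  have hupper : (p : ℝ) ^ 2 ≤ n := by
    have : p ^ 2 ≤ n := by omega
    exact_mod_cast this
  have hedges : ((affineIncidenceGraph (ZMod p)).map f).edgeSet.ncard = p ^ 3 := by
    rw [SimpleGraph.edgeSet_map, Set.ncard_image_of_injective _ f.sym2Map.injective,
      ncard_edgeSet_affineIncidenceGraph, Nat.card_zmod]
  refine ⟨(affineIncidenceGraph (ZMod p)).map f,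
    not_hasFourCycle_map f (not_hasFourCycle_affineIncidenceGraph _), ?_, ?_, fun v => ?_⟩
  · rw [hedges, Nat.cast_pow, ← hcube, ← Real.mul_rpow (by norm_num) (by positivity)]
    gcongr
  · rw [hedges, Nat.cast_pow, ← hcube, one_mul]
    gcongr
  · have hdeg : (((affineIncidenceGraph (ZMod p)).map f).neighborSet v).ncard ≤ p :=
      ncard_neighborSet_map_le f
        (fun u => by simpa using ncard_neighborSet_affineIncidenceGraph_le (ZMod p) u) v
    calc _ ≤ (p : ℝ) := mod_cast hdeg
      _ = ((p : ℝ) ^ 2) ^ ((1 : ℝ) / 2) := hroot.symm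
      _ ≤ 1 * (n : ℝ) ^ ((1 : ℝ) / 2) := by
        rw [one_mul]
        gcongr
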